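/- Let α ∈ (0,1), φ₁ > 0, and let f : [φ₁,∞) → (0,∞) be a continuous, nonincreasing function which is radially decreasing (for every fixed φ ≥ φ₁ the sequence k ↦ f(φ + 2kπ), k ∈ ℕ, is strictly decreasing). Assume there is a set D ⊆ [φ₁,∞) whose intersection with every compact interval is finite, such that f is continuously differentiable at every point of [φ₁,∞) \ D. Assume there exist positive constants m, m̄, a, M such that for all φ ≥ φ₁: m·φ^{−α} ≤ f(φ) ≤ m̄·φ^{−α} and a·φ^{−α−1} ≤ f(φ) − f(φ+2π), and |f′(φ)| ≤ M·φ^{−α−1} for every φ ∉ D. Then the graph Γ of r = f(φ) in polar coordinates satisfies dim_B Γ = 2/(1+α), i.e. its lower and upper box dimensions both equal 2/(1+α). -/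

import Mathlib

open Set Filter MeasureTheory Real

noncomputable section

/-- The Euclidean ε-neighborhood `A_ε = {y : dist(y, A) < ε}` of a set `A ⊆ ℝ²`
(with the Euclidean distance). -/
def euclNbhd (A : Set (ℝ × ℝ)) (ε : ℝ) : Set (ℝ × ℝ) :=
  {y | ∃ a ∈ A, Real.sqrt ((y.1 - a.1) ^ 2 + (y.2 - a.2) ^ 2) < ε}

/-- Lower `s`-dimensional Minkowski content of a set `A ⊆ ℝ²`:
`liminf_{ε→0⁺} vol₂(A_ε) / ε^{2-s}`. -/
def lowerMinkowskiContent (A : Set (ℝ × ℝ)) (s : ℝ) : ENNReal :=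
  Filter.liminf
    (fun ε : ℝ => MeasureTheory.volume (euclNbhd A ε) / ENNReal.ofReal (ε ^ (2 - s)))
    (nhdsWithin 0 (Set.Ioi 0))

/-- Upper `s`-dimensional Minkowski content of a set `A ⊆ ℝ²`:
`limsup_{ε→0⁺} vol₂(A_ε) / ε^{2-s}`. -/
def upperMinkowskiContent (A : Set (ℝ × ℝ)) (s : ℝ) : ENNReal :=
  Filter.limsup
    (fun ε : ℝ => MeasureTheory.volume (euclNbhd A ε) / ENNReal.ofReal (ε ^ (2 - s)))
    (nhdsWithin 0 (Set.Ioi 0))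

/-- Lower box dimension: `inf {s ≥ 0 : M_*^s(A) = 0}`. -/
def lowerBoxDim (A : Set (ℝ × ℝ)) : ℝ :=
  sInf {s : ℝ | 0 ≤ s ∧ lowerMinkowskiContent A s = 0}

/-- Upper box dimension: `inf {s ≥ 0 : M^{*s}(A) = 0}`. -/
def upperBoxDim (A : Set (ℝ × ℝ)) : ℝ :=
  sInf {s : ℝ | 0 ≤ s ∧ upperMinkowskiContent A s = 0}

end

lemma vol_ball_aux (P : ℝ × ℝ) (r : ℝ) (hr : 0 ≤ r) :
    volume (Metric.ball P r) = ENNReal.ofReal (4 * r ^ 2) := by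
  rw [← ball_prod_same, Measure.volume_eq_prod, Measure.prod_prod, Real.volume_ball,
    Real.volume_ball, ← ENNReal.ofReal_mul (by positivity)]
  congr 1; ring

lemma dims_aux (Γ : Set (ℝ × ℝ)) (s0 c C : ℝ) (hs0 : 0 ≤ s0) (hc : 0 < c)
    (hL : ∀ᶠ ε in nhdsWithin (0:ℝ) (Ioi 0),
      ENNReal.ofReal (c * ε ^ (2 - s0)) ≤ volume (euclNbhd Γ ε))
    (hU : ∀ᶠ ε in nhdsWithin (0:ℝ) (Ioi 0),
      volume (euclNbhd Γ ε) ≤ ENNReal.ofReal (C * ε ^ (2 - s0))) :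
    lowerBoxDim Γ = s0 ∧ upperBoxDim Γ = s0 := by
  have hpos : ∀ᶠ ε in nhdsWithin (0:ℝ) (Ioi 0), 0 < ε := self_mem_nhdsWithin
  have hlt : ∀ᶠ ε in nhdsWithin (0:ℝ) (Ioi 0), ε < 1 :=
    mem_nhdsWithin_of_mem_nhds (Iio_mem_nhds one_pos)
  have hbig : ∀ s, s0 < s → Tendsto
      (fun ε : ℝ => volume (euclNbhd Γ ε) / ENNReal.ofReal (ε ^ (2 - s)))
      (nhdsWithin 0 (Ioi 0)) (nhds 0) := by
    intro s hs
    have h1 : Tendsto (fun ε : ℝ => ENNReal.ofReal (C * ε ^ (s - s0)))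
        (nhdsWithin 0 (Ioi 0)) (nhds 0) := by
      have h2 : Tendsto (fun ε : ℝ => C * ε ^ (s - s0)) (nhdsWithin 0 (Ioi 0)) (nhds 0) := by
        have h3 : ContinuousAt (fun ε : ℝ => C * ε ^ (s - s0)) 0 :=
          continuousAt_const.mul (Real.continuousAt_rpow_const _ _ (Or.inr (by linarith)))
        have h4 := h3.tendsto
        simp only [Real.zero_rpow (sub_pos.2 hs).ne', mul_zero] at h4
        exact h4.mono_left nhdsWithin_le_nhds
      have := ENNReal.tendsto_ofReal h2
      simpa using this
    refine tendsto_of_tendsto_of_tendsto_of_le_of_le' tendsto_const_nhds h1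
      (Eventually.of_forall fun _ => zero_le) ?_
    filter_upwards [hU, hpos] with ε h he
    refine ENNReal.div_le_of_le_mul (h.trans ?_)
    have h0 : 0 < ε ^ (2 - s) := Real.rpow_pos_of_pos he _
    rw [← ENNReal.ofReal_mul' h0.le, mul_assoc, ← Real.rpow_add he]
    ring_nf; exact le_rfl
  have hsmall : ∀ s, s ≤ s0 → ENNReal.ofReal c ≤ lowerMinkowskiContent Γ s := by
    intro s hs
    refine le_liminf_of_le (by isBoundedDefault) ?_
    filter_upwards [hL, hpos, hlt] with ε h he he1
    have h0 : 0 < ε ^ (2 - s) := Real.rpow_pos_of_pos he _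
    rw [ENNReal.le_div_iff_mul_le (Or.inl (by simpa using h0)) (Or.inl ENNReal.ofReal_ne_top)]
    refine le_trans ?_ h
    rw [← ENNReal.ofReal_mul hc.le]
    refine ENNReal.ofReal_le_ofReal (mul_le_mul_of_nonneg_left ?_ hc.le)
    exact Real.rpow_le_rpow_of_exponent_ge he he1.le (by linarith)
  have hle : ∀ s, lowerMinkowskiContent Γ s ≤ upperMinkowskiContent Γ s := fun s =>
    liminf_le_limsup
  have hcp : 0 < ENNReal.ofReal c := by simpa using hc
  have key : ∀ S : Set ℝ, Ioi s0 ⊆ S → S ⊆ Ici s0 → sInf S = s0 := by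
    intro S h1 h2
    apply le_antisymm
    · calc sInf S ≤ sInf (Ioi s0) := csInf_le_csInf ⟨s0, fun x hx => h2 hx⟩ nonempty_Ioi h1
        _ = s0 := csInf_Ioi
    · exact le_csInf (nonempty_Ioi.mono h1) (fun x hx => h2 hx)
  constructor
  · refine key _ (fun s hs => ⟨hs0.trans (le_of_lt hs), (hbig s hs).liminf_eq⟩) ?_
    rintro s ⟨-, h⟩
    by_contra hn
    have := hsmall s (le_of_lt (not_le.1 hn))
    rw [h] at this
    exact absurd this (not_le.2 hcp)
  · refine key _ (fun s hs => ⟨hs0.trans (le_of_lt hs), (hbig s hs).limsup_eq⟩) ?_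
    rintro s ⟨-, h⟩
    by_contra hn
    have := (hsmall s (le_of_lt (not_le.1 hn))).trans (hle s)
    rw [h] at this
    exact absurd this (not_le.2 hcp)

lemma rpow_concave_aux (α φ ψ : ℝ) (hα : α ∈ Ioo (0:ℝ) 1) (h0 : 0 < φ) (h : φ ≤ ψ) :
    (1 - α) * (ψ ^ (-α) * (ψ - φ)) ≤ ψ ^ (1 - α) - φ ^ (1 - α) := by
  obtain ⟨ha0, ha1⟩ := hα
  have hψ : 0 < ψ := h0.trans_le h
  have h1 := _root_.rpow_one_add_le_one_add_mul_self (s := φ / ψ - 1) (p := 1 - α)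
    (by have : 0 < φ / ψ := by positivity
        linarith) (by linarith) (by linarith)
  rw [add_sub_cancel, Real.div_rpow h0.le hψ.le, div_le_iff₀ (by positivity)] at h1
  have h2 : ψ ^ (1 - α) = ψ ^ (-α) * ψ := by
    rw [← Real.rpow_add_one hψ.ne']; ring_nf
  have h3 : (1 + (1 - α) * (φ / ψ - 1)) * ψ ^ (1 - α)
      = ψ ^ (1 - α) - (1 - α) * (ψ ^ (-α) * (ψ - φ)) := by
    rw [h2]; field_simp; ring
  linarith

lemma upper_aux (α φ₁ : ℝ) (hα : α ∈ Ioo (0 : ℝ) 1) (hφ₁ : 0 < φ₁) (f : ℝ → ℝ)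
    (hf_pos : ∀ φ ≥ φ₁, 0 < f φ) (hf_anti : AntitoneOn f (Ici φ₁))
    (m' : ℝ) (hm' : 0 < m') (hf_bound : ∀ φ ≥ φ₁, f φ ≤ m' * φ ^ (-α))
    (Γ : Set (ℝ × ℝ))
    (hΓ : Γ = {P : ℝ × ℝ | ∃ φ ≥ φ₁, P = (f φ * Real.cos φ, f φ * Real.sin φ)}) :
    ∃ C : ℝ, ∀ x : ℝ, 0 < x → x < 1 →
      volume (euclNbhd Γ (x ^ (1 + α))) ≤ ENNReal.ofReal (C * x ^ (2 * α)) := by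
  obtain ⟨ha0, ha1⟩ := id hα
  have h1a : 0 < 1 - α := by linarith
  set B := f φ₁ + m' / (1 - α) with hB
  have hBpos : 0 < B := by have := hf_pos φ₁ le_rfl; positivity
  refine ⟨4 * (m' + 1) ^ 2 + 16 * (B + 1), fun x hx hx1 => ?_⟩
  set ε := x ^ (1 + α) with hε
  have hεpos : 0 < ε := Real.rpow_pos_of_pos hx _
  have hxα : 0 < x ^ α := Real.rpow_pos_of_pos hx _
  set S : ℝ → ℝ := fun φ => f φ₁ - f φ + m' / (1 - α) * φ ^ (1 - α) with hS
  have hSd : ∀ φ ψ, φ₁ ≤ φ → φ ≤ ψ → (f φ - f ψ) + f ψ * (ψ - φ) ≤ S ψ - S φ := by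
    intro φ ψ h1 h2
    have h3 := rpow_concave_aux α φ ψ hα (hφ₁.trans_le h1) h2
    have h4 : f ψ * (ψ - φ) ≤ m' * ψ ^ (-α) * (ψ - φ) :=
      mul_le_mul_of_nonneg_right (hf_bound ψ (h1.trans h2)) (by linarith)
    have h5 : m' * ψ ^ (-α) * (ψ - φ) ≤ m' / (1 - α) * (ψ ^ (1 - α) - φ ^ (1 - α)) := by
      calc m' * ψ ^ (-α) * (ψ - φ) = m' / (1 - α) * ((1 - α) * (ψ ^ (-α) * (ψ - φ))) := by
            field_simp
        _ ≤ _ := by gcongr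
    simp only [hS]; linarith
  have hcoord : ∀ φ ψ, φ₁ ≤ φ → φ ≤ ψ → ∀ t t' : ℝ, |t| ≤ 1 → |t - t'| ≤ ψ - φ →
      |f φ * t - f ψ * t'| ≤ S ψ - S φ := by
    intro φ ψ h1 h2 t t' ht htt
    have hanti : f ψ ≤ f φ := hf_anti h1 (h1.trans h2) h2
    have hp := hf_pos ψ (h1.trans h2)
    calc |f φ * t - f ψ * t'| = |(f φ - f ψ) * t + f ψ * (t - t')| := by ring_nf
      _ ≤ |(f φ - f ψ) * t| + |f ψ * (t - t')| := abs_add_le _ _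
      _ = (f φ - f ψ) * |t| + f ψ * |t - t'| := by
          rw [abs_mul, abs_mul, abs_of_nonneg (sub_nonneg.2 hanti), abs_of_pos hp]
      _ ≤ (f φ - f ψ) * 1 + f ψ * (ψ - φ) := by
          gcongr
      _ ≤ _ := by rw [mul_one]; exact hSd φ ψ h1 h2
  set P : ℝ → ℝ × ℝ := fun φ => (f φ * Real.cos φ, f φ * Real.sin φ) with hP
  have hcl : ∀ u v : ℝ, |Real.cos u - Real.cos v| ≤ |u - v| := fun u v => by
    have := Real.lipschitzWith_cos.dist_le_mul u v
    simpa [Real.dist_eq] using this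
  have hsl : ∀ u v : ℝ, |Real.sin u - Real.sin v| ≤ |u - v| := fun u v => by
    have := Real.lipschitzWith_sin.dist_le_mul u v
    simpa [Real.dist_eq] using this
  have hdist0 : ∀ φ ψ, φ₁ ≤ φ → φ ≤ ψ → dist (P φ) (P ψ) ≤ S ψ - S φ := by
    intro φ ψ h1 h2
    have e : |φ - ψ| = ψ - φ := by rw [abs_sub_comm, abs_of_nonneg (by linarith)]
    rw [Prod.dist_eq, Real.dist_eq, Real.dist_eq]
    exact max_le (hcoord φ ψ h1 h2 _ _ (Real.abs_cos_le_one _) (e ▸ hcl φ ψ))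
      (hcoord φ ψ h1 h2 _ _ (Real.abs_sin_le_one _) (e ▸ hsl φ ψ))
  have hdist : ∀ φ ψ, φ₁ ≤ φ → φ₁ ≤ ψ → dist (P φ) (P ψ) ≤ |S φ - S ψ| := by
    intro φ ψ h1 h2
    rcases le_total φ ψ with h | h
    · exact (hdist0 φ ψ h1 h).trans (by rw [abs_sub_comm]; exact le_abs_self _)
    · rw [dist_comm]
      exact (hdist0 ψ φ h2 h).trans (le_abs_self _)
  have hS0 : ∀ φ, φ₁ ≤ φ → 0 ≤ S φ := by
    intro φ h
    have h1 : f φ ≤ f φ₁ := hf_anti (mem_Ici.2 le_rfl) h h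
    have h2 : 0 ≤ m' / (1 - α) * φ ^ (1 - α) := by
      have := hφ₁.trans_le h; positivity
    simp only [hS]; linarith
  have hSB : ∀ φ, φ₁ ≤ φ → φ ≤ 1 / x → S φ ≤ B * x ^ (α - 1) := by
    intro φ h h'
    have h1 := hf_pos φ h
    have h0 := hφ₁.trans_le h
    have h2 : φ ^ (1 - α) ≤ x ^ (α - 1) := by
      calc φ ^ (1 - α) ≤ (1 / x) ^ (1 - α) := Real.rpow_le_rpow h0.le h' h1a.le
        _ = x ^ (α - 1) := by
          rw [one_div, Real.inv_rpow hx.le, ← Real.rpow_neg hx.le]; ring_nf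
    have h3 : 1 ≤ x ^ (α - 1) := Real.one_le_rpow_of_pos_of_le_one_of_nonpos hx hx1.le (by linarith)
    have h4 := hf_pos φ₁ le_rfl
    have h5 : m' / (1 - α) * φ ^ (1 - α) ≤ m' / (1 - α) * x ^ (α - 1) := by gcongr
    simp only [hS, hB]
    nlinarith
  set N := ⌊B * x ^ (α - 1) / ε⌋₊ + 1 with hN
  set T : ℕ → Set ℝ := fun i => {φ | φ₁ ≤ φ ∧ φ ≤ 1 / x ∧ ⌊S φ / ε⌋₊ = i} with hT
  have hch : ∀ i, ∃ c, (T i).Nonempty → c ∈ T i := by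
    intro i
    by_cases h : (T i).Nonempty
    · exact ⟨h.some, fun _ => h.some_mem⟩
    · exact ⟨0, fun h' => absurd h' h⟩
  choose c hc using hch
  have hcover : euclNbhd Γ ε ⊆ Metric.ball 0 ((m' + 1) * x ^ α) ∪
      ⋃ i ∈ Finset.range N, Metric.ball (P (c i)) (2 * ε) := by
    rintro y ⟨p, hp, hy⟩
    rw [hΓ] at hp
    obtain ⟨φ, hφ, rfl⟩ := hp
    have hyd : dist y (P φ) < ε := by
      rw [Prod.dist_eq, Real.dist_eq, Real.dist_eq]
      refine max_lt ((Real.abs_le_sqrt ?_).trans_lt hy) ((Real.abs_le_sqrt ?_).trans_lt hy)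
      · exact le_add_of_nonneg_right (sq_nonneg _)
      · exact le_add_of_nonneg_left (sq_nonneg _)
    by_cases hφx : φ ≤ 1 / x
    · right
      have hmem : φ ∈ T ⌊S φ / ε⌋₊ := ⟨hφ, hφx, rfl⟩
      obtain ⟨c1, c2, c3⟩ := hc _ ⟨φ, hmem⟩
      rw [mem_iUnion₂]
      refine ⟨⌊S φ / ε⌋₊, ?_, ?_⟩
      · rw [Finset.mem_range, hN, Nat.lt_succ_iff]
        have := hSB φ hφ hφx
        gcongr
      · set i := ⌊S φ / ε⌋₊ with hi
        have hd : |S φ - S (c i)| < ε := by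
          have a1 := Nat.floor_le (div_nonneg (hS0 φ hφ) hεpos.le)
          have a2 := Nat.lt_floor_add_one (S φ / ε)
          have a3 := Nat.floor_le (div_nonneg (hS0 (c i) c1) hεpos.le)
          have a4 := Nat.lt_floor_add_one (S (c i) / ε)
          rw [← hi] at a1 a2
          rw [c3] at a3 a4
          rw [le_div_iff₀ hεpos] at a1 a3
          rw [div_lt_iff₀ hεpos] at a2 a4
          rw [abs_lt]; constructor <;> nlinarith
        have := hdist φ (c i) hφ c1
        have := dist_triangle y (P φ) (P (c i))
        rw [Metric.mem_ball]; linarith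
    · left
      have hφx := (not_le.1 hφx).le
      have hf1 : f φ ≤ m' * x ^ α := by
        refine (hf_bound φ hφ).trans ?_
        gcongr
        calc φ ^ (-α) ≤ (1 / x) ^ (-α) :=
              Real.rpow_le_rpow_of_nonpos (by positivity) hφx (by linarith)
          _ = x ^ α := by rw [one_div, Real.inv_rpow hx.le, Real.rpow_neg hx.le, inv_inv]
      have hεx : ε ≤ x ^ α := Real.rpow_le_rpow_of_exponent_ge hx hx1.le (by linarith)
      have hp := hf_pos φ hφ
      have hP0 : dist (P φ) 0 ≤ f φ := by
        rw [Prod.dist_eq, Real.dist_eq, Real.dist_eq]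
        simp only [hP, Prod.fst_zero, Prod.snd_zero, sub_zero, abs_mul, abs_of_pos hp]
        refine max_le ?_ ?_
        · nlinarith [Real.abs_cos_le_one φ]
        · nlinarith [Real.abs_sin_le_one φ]
      have := dist_triangle y (P φ) 0
      rw [Metric.mem_ball]; linarith
  have e1 : x ^ (α - 1) * ε = x ^ (2 * α) := by
    rw [hε, ← Real.rpow_add hx]; ring_nf
  have e2 : ε ^ 2 ≤ x ^ (2 * α) := by
    rw [hε, ← Real.rpow_natCast, ← Real.rpow_mul hx.le]
    exact Real.rpow_le_rpow_of_exponent_ge hx hx1.le (by push_cast; linarith)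
  have e3 : (x ^ α) ^ 2 = x ^ (2 * α) := by
    rw [← Real.rpow_natCast, ← Real.rpow_mul hx.le]; push_cast; ring_nf
  have hNε : (N : ℝ) * ε ^ 2 ≤ (B + 1) * x ^ (2 * α) := by
    have h1 : (N : ℝ) ≤ B * x ^ (α - 1) / ε + 1 := by
      rw [hN]; push_cast
      have := Nat.floor_le (a := B * x ^ (α - 1) / ε) (by positivity)
      linarith
    calc (N : ℝ) * ε ^ 2 ≤ (B * x ^ (α - 1) / ε + 1) * ε ^ 2 := by gcongr
      _ = B * (x ^ (α - 1) * ε) + ε ^ 2 := by field_simp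
      _ ≤ _ := by rw [e1]; linarith
  calc volume (euclNbhd Γ ε) ≤ _ := measure_mono hcover
    _ ≤ _ := measure_union_le _ _
    _ ≤ ENNReal.ofReal (4 * ((m' + 1) * x ^ α) ^ 2) +
        ∑ i ∈ Finset.range N, ENNReal.ofReal (4 * (2 * ε) ^ 2) := by
        gcongr
        · rw [vol_ball_aux _ _ (by positivity)]
        · refine (measure_biUnion_finset_le _ _).trans (Finset.sum_le_sum fun i _ => ?_)
          rw [vol_ball_aux _ _ (by positivity)]
    _ = ENNReal.ofReal (4 * ((m' + 1) * x ^ α) ^ 2 + N * (4 * (2 * ε) ^ 2)) := by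
        rw [Finset.sum_const, Finset.card_range, nsmul_eq_mul,
          ENNReal.ofReal_add (by positivity) (by positivity),
          ENNReal.ofReal_mul (p := (N:ℝ)) (by positivity), ENNReal.ofReal_natCast]
    _ ≤ _ := by
        apply ENNReal.ofReal_le_ofReal
        rw [mul_pow, e3]
        nlinarith

lemma lower_core (α φ₁ : ℝ) (hα : α ∈ Ioo (0 : ℝ) 1) (f : ℝ → ℝ)
    (hf_anti : AntitoneOn f (Ici φ₁))
    (m a : ℝ) (hm : 0 < m) (ha : 0 < a)
    (hf_bound : ∀ φ ≥ φ₁, m * φ ^ (-α) ≤ f φ)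
    (hf_dec : ∀ φ ≥ φ₁, a * φ ^ (-α - 1) ≤ f φ - f (φ + 2 * Real.pi))
    (Γ : Set (ℝ × ℝ))
    (hΓ : Γ = {P : ℝ × ℝ | ∃ φ ≥ φ₁, P = (f φ * Real.cos φ, f φ * Real.sin φ)})
    (K : ℕ) (hK : 1 ≤ K) (hKφ : φ₁ ≤ K) (ε : ℝ) (hε : 0 < ε)
    (h1 : 4 * ε ≤ a * (13 * K : ℝ) ^ (-α - 1))
    (h2 : 4 * ε ≤ m * (13 * K : ℝ) ^ (-α) / (2 * K)) :
    ENNReal.ofReal (K ^ 2 * ε ^ 2) ≤ volume (euclNbhd Γ ε) := by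
  obtain ⟨ha0, ha1⟩ := hα
  have hK1 : (1:ℝ) ≤ K := by exact_mod_cast hK
  have hK0 : (0:ℝ) < K := by linarith
  have hpi3 := Real.pi_gt_three
  have hpi4 : Real.pi < 3.15 := Real.pi_lt_d2
  set A : ℕ × ℕ → ℝ := fun q => (q.1 : ℝ) / K + ((K + q.2 : ℕ) : ℝ) * (2 * Real.pi) with hA
  set I := Finset.range K ×ˢ Finset.range K with hI
  set P : ℕ × ℕ → ℝ × ℝ := fun q => (f (A q) * Real.cos (A q), f (A q) * Real.sin (A q)) with hP
  have hlow : ∀ q, φ₁ ≤ A q := by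
    intro q
    have : (0:ℝ) ≤ (q.1 : ℝ) / K := by positivity
    have : (0:ℝ) ≤ (q.2 : ℝ) := by positivity
    simp only [hA]; push_cast
    nlinarith
  have hApos : ∀ q, 0 < A q := by
    intro q
    have : (0:ℝ) ≤ (q.1 : ℝ) / K := by positivity
    have : (0:ℝ) ≤ (q.2 : ℝ) := by positivity
    simp only [hA]; push_cast
    nlinarith
  have hhigh : ∀ q ∈ I, A q ≤ 13 * K := by
    intro q hq
    rw [hI, Finset.mem_product, Finset.mem_range, Finset.mem_range] at hq
    have e1 : (q.1 : ℝ) / K ≤ 1 := by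
      rw [div_le_one hK0]; exact_mod_cast hq.1.le
    have e2 : (q.2 : ℝ) + 1 ≤ K := by exact_mod_cast hq.2
    simp only [hA]; push_cast
    nlinarith
  have hr : ∀ q ∈ I, m * (13 * K : ℝ) ^ (-α) ≤ f (A q) := by
    intro q hq
    refine le_trans ?_ (hf_bound _ (hlow q))
    exact mul_le_mul_of_nonneg_left
      (Real.rpow_le_rpow_of_nonpos (hApos q) (hhigh q hq) (by linarith)) hm.le
  set ρ := m * (13 * K : ℝ) ^ (-α) with hρ
  have hρ0 : 0 < ρ := by positivity
  -- squared separation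
  have hform : ∀ q q', ((P q).1 - (P q').1) ^ 2 + ((P q).2 - (P q').2) ^ 2
      = (f (A q) - f (A q')) ^ 2 + 2 * f (A q) * f (A q') * (1 - Real.cos (A q - A q')) := by
    intro q q'
    simp only [hP]
    rw [Real.cos_sub]
    linear_combination (f (A q)) ^ 2 * Real.sin_sq_add_cos_sq (A q)
      + (f (A q')) ^ 2 * Real.sin_sq_add_cos_sq (A q')
  have hk : ∀ j k k', (j, k) ∈ I → k < k' → 4 * ε ≤ f (A (j, k)) - f (A (j, k')) := by
    intro j k k' hq hkk
    have g1 := hf_dec _ (hlow (j, k))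
    have g2 : f (A (j, k')) ≤ f (A (j, k) + 2 * Real.pi) := by
      apply hf_anti
      · exact mem_Ici.2 (by linarith [hlow (j, k)])
      · exact hlow _
      · have : (k:ℝ) + 1 ≤ k' := by exact_mod_cast hkk
        simp only [hA]; push_cast
        nlinarith
    have g3 : a * (13 * K : ℝ) ^ (-α - 1) ≤ a * A (j, k) ^ (-α - 1) :=
      mul_le_mul_of_nonneg_left
        (Real.rpow_le_rpow_of_nonpos (hApos _) (hhigh _ hq) (by linarith)) ha.le
    linarith
  have hsep : ∀ q ∈ I, ∀ q' ∈ I, q ≠ q' →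
      (4 * ε) ^ 2 ≤ ((P q).1 - (P q').1) ^ 2 + ((P q).2 - (P q').2) ^ 2 := by
    rintro ⟨j, k⟩ hq ⟨j', k'⟩ hq' hne
    rw [hform]
    have r1 := hr _ hq
    have r2 := hr _ hq'
    have p1 := hρ0.trans_le r1
    have p2 := hρ0.trans_le r2
    by_cases hj : j = j'
    · subst hj
      have hkk : k ≠ k' := fun h => hne (by rw [h])
      have hc : 0 ≤ 1 - Real.cos (A (j, k) - A (j, k')) := by
        linarith [Real.cos_le_one (A (j, k) - A (j, k'))]
      have hc2 : 0 ≤ 2 * f (A (j, k)) * f (A (j, k')) * (1 - Real.cos (A (j, k) - A (j, k'))) := by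
        positivity
      rcases lt_or_gt_of_ne hkk with h | h
      · have := hk j k k' hq h
        nlinarith
      · have := hk j k' k hq' h
        nlinarith
    · set δ : ℝ := ((j:ℝ) - j') / K with hδ
      rw [hI, Finset.mem_product, Finset.mem_range, Finset.mem_range] at hq hq'
      simp only at hq hq'
      have hcos : Real.cos (A (j, k) - A (j', k')) = Real.cos δ := by
        have : A (j, k) - A (j', k') = δ + (((k:ℤ) - k' : ℤ) : ℝ) * (2 * Real.pi) := by
          simp only [hA, hδ]; push_cast; ring
        rw [this, Real.cos_add_int_mul_two_pi]
      have hδ1 : |δ| ≤ Real.pi := by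
        have : |(j:ℝ) - j'| ≤ K := by
          have b1 : (j:ℝ) ≤ K := by exact_mod_cast hq.1.le
          have b2 : (j':ℝ) ≤ K := by exact_mod_cast hq'.1.le
          have b3 : (0:ℝ) ≤ j := by positivity
          have b4 : (0:ℝ) ≤ j' := by positivity
          rw [abs_le]; constructor <;> linarith
        rw [hδ, abs_div, abs_of_pos hK0, div_le_iff₀ hK0]
        nlinarith
      have hδ2 : 1 / (K:ℝ) ^ 2 ≤ δ ^ 2 := by
        rw [hδ, div_pow]
        gcongr
        have : (1:ℤ) ≤ ((j:ℤ) - j') ^ 2 := by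
          have : ((j:ℤ) - j') ≠ 0 := by omega
          have := sq_pos_of_ne_zero this
          omega
        exact_mod_cast this
      have hq1 := Real.cos_le_one_sub_mul_cos_sq hδ1
      have hq2 : 1 / 8 * δ ^ 2 ≤ 2 / Real.pi ^ 2 * δ ^ 2 := by
        refine mul_le_mul_of_nonneg_right ?_ (sq_nonneg _)
        rw [div_le_div_iff₀ (by norm_num) (by positivity)]
        nlinarith
      rw [hcos]
      have hc : 1 / 8 * (1 / (K:ℝ) ^ 2) ≤ 1 - Real.cos δ := by linarith
      calc (4 * ε) ^ 2 ≤ (ρ / (2 * K)) ^ 2 := by gcongr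
        _ = 2 * ρ * ρ * (1 / 8 * (1 / (K:ℝ) ^ 2)) := by field_simp; norm_num
        _ ≤ 2 * f (A (j, k)) * f (A (j', k')) * (1 - Real.cos δ) := by gcongr
        _ ≤ _ := le_add_of_nonneg_left (sq_nonneg _)
  have hdisj : (I : Set (ℕ × ℕ)).PairwiseDisjoint (fun q => Metric.ball (P q) (ε / 2)) := by
    intro q hq q' hq' hne
    refine Set.disjoint_left.2 fun y hy hy' => ?_
    have hs := hsep q hq q' hq' hne
    rw [Metric.mem_ball] at hy hy'
    have hd : dist (P q) (P q') < ε := by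
      have := dist_triangle_left (P q) (P q') y
      linarith
    rw [Prod.dist_eq, Real.dist_eq, Real.dist_eq, max_lt_iff] at hd
    have d1 := sq_lt_sq' (by linarith [abs_lt.1 hd.1]) (abs_lt.1 hd.1).2
    have d2 := sq_lt_sq' (by linarith [abs_lt.1 hd.2]) (abs_lt.1 hd.2).2
    nlinarith
  have hsub : (⋃ q ∈ I, Metric.ball (P q) (ε / 2)) ⊆ euclNbhd Γ ε := by
    intro y hy
    rw [mem_iUnion₂] at hy
    obtain ⟨q, hq, hy⟩ := hy
    refine ⟨P q, ?_, ?_⟩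
    · rw [hΓ]; exact ⟨A q, hlow q, rfl⟩
    · rw [Metric.mem_ball, Prod.dist_eq, Real.dist_eq, Real.dist_eq, max_lt_iff] at hy
      rw [Real.sqrt_lt' hε]
      have d1 := sq_lt_sq' (by linarith [abs_lt.1 hy.1]) (abs_lt.1 hy.1).2
      have d2 := sq_lt_sq' (by linarith [abs_lt.1 hy.2]) (abs_lt.1 hy.2).2
      nlinarith
  calc ENNReal.ofReal (K ^ 2 * ε ^ 2)
      = ∑ q ∈ I, volume (Metric.ball (P q) (ε / 2)) := by
        simp_rw [vol_ball_aux _ _ (by positivity : 0 ≤ ε / 2)]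
        rw [Finset.sum_const, hI, Finset.card_product, Finset.card_range, nsmul_eq_mul,
          ← ENNReal.ofReal_natCast, ← ENNReal.ofReal_mul (by positivity)]
        congr 1; push_cast; ring
    _ = volume (⋃ q ∈ I, Metric.ball (P q) (ε / 2)) :=
        (measure_biUnion_finset hdisj fun q _ => measurableSet_ball).symm
    _ ≤ _ := measure_mono hsub

lemma lower_aux (α φ₁ : ℝ) (hα : α ∈ Ioo (0 : ℝ) 1) (hφ₁ : 0 < φ₁) (f : ℝ → ℝ)
    (hf_anti : AntitoneOn f (Ici φ₁))
    (m a : ℝ) (hm : 0 < m) (ha : 0 < a)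
    (hf_bound : ∀ φ ≥ φ₁, m * φ ^ (-α) ≤ f φ)
    (hf_dec : ∀ φ ≥ φ₁, a * φ ^ (-α - 1) ≤ f φ - f (φ + 2 * Real.pi))
    (Γ : Set (ℝ × ℝ))
    (hΓ : Γ = {P : ℝ × ℝ | ∃ φ ≥ φ₁, P = (f φ * Real.cos φ, f φ * Real.sin φ)}) :
    ∃ c > 0, ∃ x0 > 0, ∀ x : ℝ, 0 < x → x < x0 →
      ENNReal.ofReal (c * x ^ (2 * α)) ≤ volume (euclNbhd Γ (x ^ (1 + α))) := by
  obtain ⟨ha0, ha1⟩ := id hα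
  set c0 := min a m * (13:ℝ) ^ (-α - 1) with hc0
  have hmin : 0 < min a m := lt_min ha hm
  have hc0p : 0 < c0 := by positivity
  set η := min 1 (c0 / 4) with hη
  have hηp : 0 < η := lt_min one_pos (by positivity)
  refine ⟨η ^ 2 / 4, by positivity, η / (2 * (1 + φ₁)), by positivity, fun x hx hxx => ?_⟩
  set ε := x ^ (1 + α) with hε
  have hεp : 0 < ε := Real.rpow_pos_of_pos hx _
  set K := ⌊η / x⌋₊ with hKdef
  have hbig : 1 + φ₁ ≤ η / (2 * x) := by
    rw [lt_div_iff₀ (by positivity)] at hxx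
    rw [le_div_iff₀ (by positivity)]
    nlinarith
  have hhalf : η / x = 2 * (η / (2 * x)) := by field_simp
  have hKl : η / (2 * x) ≤ K := by
    have := Nat.lt_floor_add_one (η / x)
    rw [← hKdef] at this
    linarith
  have hKu : (K : ℝ) ≤ η / x := Nat.floor_le (by positivity)
  have hK1 : (1:ℝ) ≤ K := by linarith
  have hK0 : (0:ℝ) < K := by linarith
  have hmain : 4 * ε ≤ c0 * (K:ℝ) ^ (-α - 1) := by
    have g1 : (η / x) ^ (-α - 1) ≤ (K:ℝ) ^ (-α - 1) :=
      Real.rpow_le_rpow_of_nonpos hK0 hKu (by linarith)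
    have g2 : (η / x) ^ (-α - 1) = ε / η ^ (1 + α) := by
      rw [Real.div_rpow hηp.le hx.le, show -α - 1 = -(1 + α) by ring, Real.rpow_neg hηp.le,
        Real.rpow_neg hx.le, hε]
      field_simp
    have g3 : η ^ (1 + α) ≤ c0 / 4 := by
      calc η ^ (1 + α) ≤ η ^ (1:ℝ) :=
            Real.rpow_le_rpow_of_exponent_ge hηp (min_le_left _ _) (by linarith)
        _ = η := Real.rpow_one _
        _ ≤ _ := min_le_right _ _
    have g4 : 0 < η ^ (1 + α) := Real.rpow_pos_of_pos hηp _
    calc 4 * ε ≤ c0 * (ε / η ^ (1 + α)) := by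
          rw [← mul_div_assoc, le_div_iff₀ g4]
          nlinarith
      _ ≤ _ := by rw [← g2]; gcongr
  have hsplit : (13 * K : ℝ) ^ (-α - 1) = (13:ℝ) ^ (-α - 1) * (K:ℝ) ^ (-α - 1) :=
    Real.mul_rpow (by norm_num) hK0.le
  have hmain2 : 4 * ε ≤ min a m * (13 * K : ℝ) ^ (-α - 1) := by
    rw [hsplit, ← mul_assoc]; exact hmain
  have hpp : 0 < (13 * K : ℝ) ^ (-α - 1) := by positivity
  have hcore := lower_core α φ₁ hα f hf_anti m a hm ha hf_bound hf_dec Γ hΓ K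
    (by exact_mod_cast hK1) (by linarith) ε hεp
    (hmain2.trans (by gcongr; exact min_le_left _ _)) (by
      refine hmain2.trans ?_
      rw [Real.rpow_sub_one (by positivity)]
      calc min a m * ((13 * K : ℝ) ^ (-α) / (13 * K))
          ≤ m * ((13 * K : ℝ) ^ (-α) / (2 * K)) := by
            gcongr
            · exact min_le_right _ _
            · norm_num
        _ = _ := by ring)
  refine le_trans (ENNReal.ofReal_le_ofReal ?_) hcore
  have e2 : ε ^ 2 = x ^ 2 * x ^ (2 * α) := by
    rw [hε, ← Real.rpow_natCast, ← Real.rpow_natCast, ← Real.rpow_mul hx.le, ← Real.rpow_add hx]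
    push_cast; ring_nf
  calc η ^ 2 / 4 * x ^ (2 * α) = (η / (2 * x)) ^ 2 * ε ^ 2 := by rw [e2]; field_simp; norm_num
    _ ≤ _ := by gcongr

/-- Dimension of a piecewise smooth nonincreasing spiral
(Theorem `novizuzu`). -/
theorem box_dimension_of_piecewise_smooth_spiral
    (α φ₁ : ℝ) (hα : α ∈ Set.Ioo (0 : ℝ) 1) (hφ₁ : 0 < φ₁)
    (f : ℝ → ℝ)
    (hf_pos : ∀ φ ≥ φ₁, 0 < f φ)
    (hf_cont : ContinuousOn f (Set.Ici φ₁))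
    (hf_anti : AntitoneOn f (Set.Ici φ₁))
    (hf_rad : ∀ φ ≥ φ₁, StrictAnti (fun k : ℕ => f (φ + 2 * (k : ℝ) * Real.pi)))
    (D : Set ℝ) (hD : D ⊆ Set.Ici φ₁)
    (hD_fin : ∀ a b : ℝ, (D ∩ Set.Icc a b).Finite)
    (hf_smooth : ∀ φ ∈ Set.Ici φ₁ \ D, ContDiffWithinAt ℝ 1 f (Set.Ici φ₁) φ)
    (m m' a M : ℝ) (hm : 0 < m) (hm' : 0 < m') (ha : 0 < a) (hM : 0 < M)
    (hf_bound : ∀ φ ≥ φ₁, m * φ ^ (-α) ≤ f φ ∧ f φ ≤ m' * φ ^ (-α))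
    (hf_dec : ∀ φ ≥ φ₁, a * φ ^ (-α - 1) ≤ f φ - f (φ + 2 * Real.pi))
    (hf'_bound : ∀ φ ∈ Set.Ici φ₁ \ D,
      |derivWithin f (Set.Ici φ₁) φ| ≤ M * φ ^ (-α - 1))
    (Γ : Set (ℝ × ℝ))
    (hΓ : Γ = {P : ℝ × ℝ | ∃ φ ≥ φ₁, P = (f φ * Real.cos φ, f φ * Real.sin φ)}) :
    lowerBoxDim Γ = 2 / (1 + α) ∧ upperBoxDim Γ = 2 / (1 + α) := by
  obtain ⟨ha0, ha1⟩ := id hα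
  obtain ⟨C, hC⟩ := upper_aux α φ₁ hα hφ₁ f hf_pos hf_anti m' hm'
    (fun φ h => (hf_bound φ h).2) Γ hΓ
  obtain ⟨c, hc, x0, hx0, hL⟩ := lower_aux α φ₁ hα hφ₁ f hf_anti m a hm ha
    (fun φ h => (hf_bound φ h).1) hf_dec Γ hΓ
  have hp : 0 < 1 / (1 + α) := by positivity
  have hx : Tendsto (fun ε : ℝ => ε ^ (1 / (1 + α))) (nhdsWithin 0 (Ioi 0)) (nhds 0) := by
    have h3 : ContinuousAt (fun ε : ℝ => ε ^ (1 / (1 + α))) 0 :=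
      Real.continuousAt_rpow_const _ _ (Or.inr hp.le)
    have h4 := h3.tendsto
    simp only [Real.zero_rpow hp.ne'] at h4
    exact h4.mono_left nhdsWithin_le_nhds
  have hpos : ∀ᶠ ε in nhdsWithin (0:ℝ) (Ioi 0), 0 < ε := self_mem_nhdsWithin
  have e1 : ∀ ε : ℝ, 0 < ε → (ε ^ (1 / (1 + α))) ^ (1 + α) = ε := by
    intro ε he
    rw [← Real.rpow_mul he.le, one_div_mul_cancel (by positivity), Real.rpow_one]
  have e2 : ∀ ε : ℝ, 0 < ε → (ε ^ (1 / (1 + α))) ^ (2 * α) = ε ^ (2 - 2 / (1 + α)) := by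
    intro ε he
    rw [← Real.rpow_mul he.le]
    congr 1
    field_simp
    ring
  refine dims_aux Γ (2 / (1 + α)) c C (by positivity) hc ?_ ?_
  · filter_upwards [hpos, hx.eventually (gt_mem_nhds hx0)] with ε he h
    have := hL _ (Real.rpow_pos_of_pos he _) h
    rwa [e1 ε he, e2 ε he] at this
  · filter_upwards [hpos, hx.eventually (gt_mem_nhds one_pos)] with ε he h
    have := hC _ (Real.rpow_pos_of_pos he _) h
    rwa [e1 ε he, e2 ε he] at this
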